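/- Let μ = ω₂^∨ = (1/2, 1/2), J = 𝕊 := {s₁, s₂}, σ = id, τ := τ₂. Then: (i) EO^J_{σ,cox}(μ) = {τ, s₀τ}; (ii) EO^J(μ) ∖ EO^J_{σ,cox}(μ) = {s₀s₁τ, s₀s₁s₀τ}; (iii) both elements of the complement are σ-straight; (iv) their Newton points are ν̄_{s₀s₁τ} = (1/2, 0) and ν̄_{s₀s₁s₀τ} = (1/2, 1/2). -/

import Mathlib

/- Extended affine Weyl group of type C̃₂ with X = {λ ∈ (1/2)ℤ² : λ₁-λ₂ ∈ ℤ}, realized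
   inside the permutation group of ℚ²: t^λ·u acts by x ↦ λ + u(x), u a signed permutation. -/

open Classical
noncomputable section

abbrev V2 := Fin 2 → ℚ
abbrev Wt2 := Equiv.Perm V2

/-- translation t^λ -/
def transl (lam : V2) : Wt2 := Equiv.addLeft lam
/-- coordinate permutation -/
def permV (u : Equiv.Perm (Fin 2)) : Wt2 := u.arrowCongr (Equiv.refl ℚ)
/-- sign change in coordinate j -/
def negAt (j : Fin 2) : Wt2 :=
  Function.Involutive.toPerm (fun v => fun i => if i = j then -(v i) else v i)
    (by intro v; funext i; by_cases h : i = j <;> simp [h])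
/-- standard basis vector -/
def eV (i : Fin 2) : V2 := Pi.single i 1
/-- standard inner product -/
def dotp (v w : V2) : ℚ := ∑ i, v i * w i
/-- the linear part of an affine transformation -/
def linp (w : Wt2) : V2 → V2 := fun x => w x - w 0

/-- s₁ : the transposition of the two coordinates -/
def s1 : Wt2 := permV (Equiv.swap 0 1)
/-- s₂ : the sign change in coordinate 2 -/
def s2 : Wt2 := negAt 1
/-- s₀ = t^{e₁}·(sign change in coordinate 1) -/
def s0 : Wt2 := transl (eV 0) * negAt 0
/-- r : e₁ ↦ -e₂, e₂ ↦ -e₁ -/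
def rC : Wt2 := negAt 0 * (negAt 1 * permV (Equiv.swap 0 1))
/-- the length-zero element τ₂ = t^{(1/2,1/2)}·r -/
def tau2 : Wt2 := transl (fun _ => 1/2) * rC

/-- the set S̃ of simple reflections of W_a -/
def St : Set Wt2 := {s0, s1, s2}
/-- Ω = {1, τ₂} -/
def Om : Set Wt2 := {1, tau2}

/-- the positive roots e₁-e₂, e₁+e₂, 2e₁, 2e₂ -/
def PhiC2 : Set V2 := {eV 0 - eV 1, eV 0 + eV 1, eV 0 + eV 0, eV 1 + eV 1}

/-- the contribution of a positive root α to the length of w = t^λ·u -/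
def lterm (w : Wt2) (α : V2) : ℚ :=
  if linp w⁻¹ α ∈ PhiC2 then |dotp (w 0) α| else |dotp (w 0) α - 1|

/-- the length function on W̃ -/
def ell (w : Wt2) : ℚ :=
  lterm w (eV 0 - eV 1) + lterm w (eV 0 + eV 1) + lterm w (eV 0 + eV 0) + lterm w (eV 1 + eV 1)

/-- `l` is a reduced word for `w` in the Coxeter system (W_a, S̃) -/
def IsRed (w : Wt2) (l : List Wt2) : Prop :=
  (∀ s ∈ l, s ∈ St) ∧ l.prod = w ∧ (l.length : ℚ) = ell w

/-- Bruhat order on W_a, via the subword property -/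
def bleWa (u u' : Wt2) : Prop :=
  ∃ l l' : List Wt2, IsRed u' l ∧ l'.Sublist l ∧ l'.prod = u

/-- Bruhat order on W̃ = W_a ⊔ W_a·τ₂ -/
def ble (w w' : Wt2) : Prop :=
  ∃ u u' om, om ∈ Om ∧ w = u * om ∧ w' = u' * om ∧ bleWa u u'

/-- the finite Weyl group W₀ = {±1}² ⋊ S₂, generated by s₁, s₂ -/
def W0 : Subgroup Wt2 := Subgroup.closure {s1, s2}

/-- the admissible set Adm(μ) -/
def Adm (μ : V2) : Set Wt2 := {w | ∃ x ∈ W0, ble w (transl ((x : Wt2) μ))}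

/-- the standard parabolic subgroup W_J -/
def WJ (J : Set Wt2) : Subgroup Wt2 := Subgroup.closure J

/-- ^JW̃ : elements of minimal length in their coset W_J·w -/
def minJ (J : Set Wt2) : Set Wt2 := {w | ∀ x ∈ WJ J, ell w ≤ ell (x * w)}

/-- the Ekedahl-Oort elements EO^J(μ) = (W_J·Adm(μ)·W_J) ∩ ^JW̃ -/
def EO (J : Set Wt2) (μ : V2) : Set Wt2 :=
  {w | (∃ x ∈ WJ J, ∃ y ∈ WJ J, ∃ a ∈ Adm μ, w = x * a * y) ∧ w ∈ minJ J}

/-- δ_w = Ad(ω) ∘ σ -/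
def deltaW (sig : MulAut Wt2) (om : Wt2) : MulAut Wt2 := MulAut.conj om * sig

/-- supp_σ(w) for w = u·ω -/
def suppsig (sig : MulAut Wt2) (w : Wt2) : Set Wt2 :=
  {s | ∃ u om l, om ∈ Om ∧ w = u * om ∧ IsRed u l ∧
        ∃ s0 ∈ l, ∃ m : ℤ, s = ((deltaW sig om) ^ m) s0}

/-- the number of orbits of an automorphism δ on a set A -/
def orbCount (δ : MulAut Wt2) (A : Set Wt2) : ℕ :=
  {O : Set Wt2 | ∃ s ∈ A, O = {t | ∃ m : ℤ, (δ ^ m) s = t}}.ncard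

/-- w = u·ω is a σ-Coxeter element of W_{supp_σ(w)} -/
def IsCox (sig : MulAut Wt2) (w : Wt2) : Prop :=
  ∃ u om, om ∈ Om ∧ w = u * om ∧
    ell u = (orbCount (deltaW sig om) (suppsig sig w) : ℚ)

/-- EO^J_{σ,cox}(μ) -/
def EOcox (sig : MulAut Wt2) (J : Set Wt2) (μ : V2) : Set Wt2 :=
  {w | w ∈ EO J μ ∧ suppsig sig w ≠ St ∧ IsCox sig w}

/-- w·σ(w)·σ²(w)⋯σ^{m-1}(w) -/
def sigmaProd (sig : MulAut Wt2) (w : Wt2) (m : ℕ) : Wt2 :=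
  (((List.range m).map fun k => (sig ^ k) w)).prod

/-- w is σ-straight -/
def IsStraight (sig : MulAut Wt2) (w : Wt2) : Prop :=
  ∀ m : ℕ, 1 ≤ m → ell (sigmaProd sig w m) = m * ell w

/-- ν is the Newton point of w -/
def IsNewton (sig : MulAut Wt2) (w : Wt2) (ν : V2) : Prop :=
  ∃ (m : ℕ) (lam : V2), 1 ≤ m ∧ sig ^ m = 1 ∧ sigmaProd sig w m = transl lam ∧
    (∃ x ∈ W0, ν = (x : Wt2) (fun j => lam j / (m : ℚ))) ∧
    ν 1 ≤ ν 0 ∧ 0 ≤ ν 1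

/-- Combinatorial model of the affine maps
`x ↦ (a / 2 ± x_{π 0}, b / 2 ± x_{π 1})` of `ℚ²`: the flag `p` records whether `π` is the
transposition, and `e`, `f` record whether the respective sign is negative. -/
@[ext] structure SgnAff where
  p : Bool
  e : Bool
  f : Bool
  a : ℤ
  b : ℤ
deriving DecidableEq

namespace SgnAff

/-- The sign attached to a flag. -/
def sg (e : Bool) : ℤ := if e then -1 else 1

instance : Mul SgnAff where
  mul m n :=
    ⟨xor m.p n.p, xor m.e (if m.p then n.f else n.e), xor m.f (if m.p then n.e else n.f),
      m.a + sg m.e * (if m.p then n.b else n.a), m.b + sg m.f * (if m.p then n.a else n.b)⟩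

instance : One SgnAff where
  one := ⟨false, false, false, 0, 0⟩

instance : Inv SgnAff where
  inv m :=
    ⟨m.p, if m.p then m.f else m.e, if m.p then m.e else m.f,
      if m.p then -(sg m.f * m.b) else -(sg m.e * m.a),
      if m.p then -(sg m.e * m.a) else -(sg m.f * m.b)⟩

theorem mul_def (m n : SgnAff) : m * n =
    ⟨xor m.p n.p, xor m.e (if m.p then n.f else n.e), xor m.f (if m.p then n.e else n.f),
      m.a + sg m.e * (if m.p then n.b else n.a), m.b + sg m.f * (if m.p then n.a else n.b)⟩ :=
  rfl

theorem one_def : (1 : SgnAff) = ⟨false, false, false, 0, 0⟩ := rfl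

theorem inv_def (m : SgnAff) : m⁻¹ =
    ⟨m.p, if m.p then m.f else m.e, if m.p then m.e else m.f,
      if m.p then -(sg m.f * m.b) else -(sg m.e * m.a),
      if m.p then -(sg m.e * m.a) else -(sg m.f * m.b)⟩ :=
  rfl

instance : Group SgnAff :=
  Group.ofLeftAxioms
    (by
      rintro ⟨p, e, f, a, b⟩ ⟨p', e', f', a', b'⟩ ⟨p'', e'', f'', a'', b''⟩
      cases p <;> cases p' <;> cases e <;> cases f <;> cases e' <;> cases f' <;>
        simp [mul_def, sg] <;> constructor <;> ring)
    (by rintro ⟨p, e, f, a, b⟩; simp [mul_def, one_def, sg])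
    (by
      rintro ⟨p, e, f, a, b⟩
      cases p <;> cases e <;> cases f <;> simp [mul_def, one_def, inv_def, sg])

/-- The map of `ℚ²` underlying an element of the model. -/
def act (m : SgnAff) (x : V2) : V2 :=
  ![m.a / 2 + sg m.e * (if m.p then x 1 else x 0), m.b / 2 + sg m.f * (if m.p then x 0 else x 1)]

theorem act_mul (m n : SgnAff) (x : V2) : act (m * n) x = act m (act n x) := by
  obtain ⟨p, e, f, a, b⟩ := m
  obtain ⟨p', e', f', a', b'⟩ := n
  funext i
  fin_cases i <;> cases p <;> cases p' <;> cases e <;> cases f <;> cases e' <;> cases f' <;>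
    simp [act, mul_def, sg] <;> ring

theorem act_one (x : V2) : act 1 x = x := by
  funext i
  fin_cases i <;> simp [act, one_def, sg]

/-- The model acts faithfully on `ℚ²`. -/
def toPerm : SgnAff →* Wt2 where
  toFun m := ⟨act m, act m⁻¹, fun x => by rw [← act_mul, inv_mul_cancel, act_one],
    fun x => by rw [← act_mul, mul_inv_cancel, act_one]⟩
  map_one' := Equiv.ext act_one
  map_mul' m n := Equiv.ext (act_mul m n)

theorem toPerm_apply (m : SgnAff) (x : V2) : toPerm m x = act m x := rfl

theorem toPerm_injective : Function.Injective toPerm := by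
  rw [injective_iff_map_eq_one]
  rintro ⟨p, e, f, a, b⟩ h
  have h0 := congrFun (DFunLike.congr_fun h 0) 0
  have h1 := congrFun (DFunLike.congr_fun h 0) 1
  have h2 := congrFun (DFunLike.congr_fun h ![1, 2]) 0
  have h3 := congrFun (DFunLike.congr_fun h ![1, 2]) 1
  simp only [toPerm_apply, act, Equiv.Perm.one_apply] at h0 h1 h2 h3
  simp at h0 h1
  subst h0 h1
  cases p <;> cases e <;> cases f <;>
    first | rfl | (revert h2 h3; norm_num [sg])

/-- The simple reflections `s₀, s₁, s₂` in the model. -/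
def gen : Fin 3 → SgnAff :=
  ![⟨false, true, false, 2, 0⟩, ⟨true, false, false, 0, 0⟩, ⟨false, false, true, 0, 0⟩]

/-- The element `τ₂` in the model. -/
def tau : SgnAff := ⟨true, true, true, 1, 1⟩

theorem negAt_apply (j : Fin 2) (v : V2) (i : Fin 2) :
    negAt j v i = if i = j then -v i else v i := rfl

theorem permV_apply (u : Equiv.Perm (Fin 2)) (v : V2) (i : Fin 2) :
    permV u v i = v (u.symm i) := rfl

theorem toPerm_gen_zero : toPerm (gen 0) = s0 := by
  ext x i
  fin_cases i <;> simp [toPerm_apply, act, gen, s0, transl, negAt_apply, eV, sg]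

theorem toPerm_gen_one : toPerm (gen 1) = s1 := by
  ext x i
  fin_cases i <;> simp [toPerm_apply, act, gen, s1, permV_apply, sg]

theorem toPerm_gen_two : toPerm (gen 2) = s2 := by
  ext x i
  fin_cases i <;> simp [toPerm_apply, act, gen, s2, negAt_apply, sg]

theorem toPerm_tau : toPerm tau = tau2 := by
  ext x i
  fin_cases i <;> simp [toPerm_apply, act, tau, tau2, rC, transl, negAt_apply, permV_apply, sg]

theorem toPerm_transl (a b : ℤ) : toPerm ⟨false, false, false, a, b⟩ = transl ![a / 2, b / 2] := by
  ext x i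
  fin_cases i <;> simp [toPerm_apply, act, transl, sg]

/-- Twice the length function. -/
def twiceLen (m : SgnAff) : ℤ :=
  |m.a - m.b - (if (if m.p then !m.f else m.e) then 2 else 0)| +
  |m.a + m.b - (if (if m.p then m.f else m.e) then 2 else 0)| +
  2 * |m.a - (if m.e then 1 else 0)| + 2 * |m.b - (if m.f then 1 else 0)|

theorem mem_PhiC2 (v : V2) : v ∈ PhiC2 ↔ (v 0 = 1 ∧ v 1 = -1) ∨ (v 0 = 1 ∧ v 1 = 1) ∨
    (v 0 = 2 ∧ v 1 = 0) ∨ (v 0 = 0 ∧ v 1 = 2) := by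
  simp [PhiC2, funext_iff, Fin.forall_fin_two, eV, one_add_one_eq_two]

theorem lterm_toPerm (m : SgnAff) (x y : ℚ) (α : V2) (hx : α 0 = x) (hy : α 1 = y) :
    lterm (toPerm m) α =
      if (![if m.p then sg m.f * y else sg m.e * x, if m.p then sg m.e * x else sg m.f * y] : V2)
        ∈ PhiC2 then |(m.a * x + m.b * y) / 2| else |(m.a * x + m.b * y) / 2 - 1| := by
  have h1 : linp (toPerm m)⁻¹ α =
      ![if m.p then sg m.f * y else sg m.e * x, if m.p then sg m.e * x else sg m.f * y] := by
    rw [← map_inv]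
    obtain ⟨p, e, f, a, b⟩ := m
    funext i
    fin_cases i <;> cases p <;> simp [linp, toPerm_apply, act, inv_def, hx, hy]
  have h2 : dotp (toPerm m 0) α = (m.a * x + m.b * y) / 2 := by
    simp [dotp, toPerm_apply, act, hx, hy]
    ring
  rw [lterm, h1, h2]

theorem ell_toPerm (m : SgnAff) : ell (toPerm m) = (twiceLen m : ℚ) / 2 := by
  rw [ell, lterm_toPerm m 1 (-1) _ (by simp [eV]) (by simp [eV]),
    lterm_toPerm m 1 1 _ (by simp [eV]) (by simp [eV]),
    lterm_toPerm m 2 0 _ (by simp [eV, one_add_one_eq_two]) (by simp [eV]),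
    lterm_toPerm m 0 2 _ (by simp [eV]) (by simp [eV, one_add_one_eq_two])]
  have half (x : ℚ) : |x / 2| = |x| / 2 := by rw [abs_div, abs_two]
  have half' (x : ℚ) : |x / 2 - 1| = |x - 2| / 2 := by rw [← half]; ring_nf
  have two (x : ℚ) : |x * 2| = 2 * |x| := by rw [abs_mul, abs_two, mul_comm]
  have two' (x : ℚ) : |x * 2 - 2| = 2 * |x - 1| := by rw [← two]; ring_nf
  obtain ⟨p, e, f, a, b⟩ := m
  cases p <;> cases e <;> cases f <;>
    norm_num [mem_PhiC2, sg, twiceLen, half, half', two, two'] <;> ring_nf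

theorem mem_St_iff (s : Wt2) : s ∈ St ↔ ∃ i, toPerm (gen i) = s := by
  simp [St, Fin.exists_fin_succ, ← toPerm_gen_zero, ← toPerm_gen_one, ← toPerm_gen_two, eq_comm]

/-- The element of the model spelled by a word in the simple reflections. -/
def word (l : List (Fin 3)) : SgnAff := (l.map gen).prod

theorem prod_map_toPerm (l : List (Fin 3)) :
    (l.map fun i => toPerm (gen i)).prod = toPerm (word l) := by
  rw [word, map_list_prod, List.map_map]; rfl

theorem even_word (l : List (Fin 3)) : Even (word l).a ∧ Even (word l).b := by
  induction l with
  | nil => decide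
  | cons i l ih =>
    obtain ⟨ha, hb⟩ := ih
    have : word (i :: l) = gen i * word l := by simp [word]
    rw [this]
    fin_cases i <;> simp [gen, mul_def, sg, ha, hb, Int.even_add]

theorem exists_word {l : List Wt2} (hl : ∀ s ∈ l, s ∈ St) :
    ∃ l' : List (Fin 3), l = l'.map fun i => toPerm (gen i) := by
  induction l with
  | nil => exact ⟨[], rfl⟩
  | cons s l ih =>
    obtain ⟨l', rfl⟩ := ih fun t ht => hl t (List.mem_cons_of_mem _ ht)
    obtain ⟨i, rfl⟩ := (mem_St_iff s).1 (hl s List.mem_cons_self)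
    exact ⟨i :: l', rfl⟩

theorem isRed_toPerm (l : List (Fin 3)) (h : 2 * (l.length : ℤ) = twiceLen (word l)) :
    IsRed (toPerm (word l)) (l.map fun i => toPerm (gen i)) := by
  refine ⟨?_, prod_map_toPerm l, ?_⟩
  · simp only [List.mem_map]
    rintro _ ⟨i, -, rfl⟩
    exact (mem_St_iff _).2 ⟨i, rfl⟩
  · rw [ell_toPerm, ← h]
    simp

/-- In the coset `W_a τ₂`, the component in `Ω` is forced to be `τ₂`, and the component in `W_a`
has a reduced word. -/
theorem word_of_odd {m : SgnAff} (hm : Odd m.a) {u om : Wt2} {l : List Wt2} (hom : om ∈ Om)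
    (h : toPerm m = u * om) (hl : IsRed u l) :
    om = tau2 ∧ ∃ l' : List (Fin 3), l = l'.map (fun i => toPerm (gen i)) ∧
      word l' = m * tau⁻¹ ∧ 2 * (l'.length : ℤ) = twiceLen (m * tau⁻¹) := by
  obtain ⟨hSt, rfl, hlen⟩ := hl
  obtain ⟨l', rfl⟩ := exists_word hSt
  rw [prod_map_toPerm] at h hlen
  rcases hom with rfl | rfl
  · rw [mul_one] at h
    rw [toPerm_injective h] at hm
    exact absurd (even_word l').1 (Int.not_even_iff_odd.2 hm)
  · rw [← toPerm_tau, ← map_mul] at h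
    have hw : word l' = m * tau⁻¹ := by rw [toPerm_injective h, mul_inv_cancel_right]
    refine ⟨rfl, l', rfl, hw, ?_⟩
    rw [ell_toPerm, hw, List.length_map] at hlen
    have : (2 * (l'.length : ℤ) : ℚ) = twiceLen (m * tau⁻¹) := by
      push_cast
      linarith
    exact_mod_cast this

theorem exists_linear_of_mem_W0 {x : Wt2} (hx : x ∈ W0) :
    ∃ p e f, x = toPerm ⟨p, e, f, 0, 0⟩ := by
  induction hx using Subgroup.closure_induction with
  | mem x hx =>
    rcases hx with rfl | rfl
    · exact ⟨_, _, _, toPerm_gen_one.symm⟩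
    · exact ⟨_, _, _, toPerm_gen_two.symm⟩
  | one => exact ⟨_, _, _, (map_one toPerm).symm⟩
  | mul x y _ _ hx hy =>
    obtain ⟨p, e, f, rfl⟩ := hx
    obtain ⟨p', e', f', rfl⟩ := hy
    exact ⟨_, _, _, by rw [← map_mul, mul_def]; simp; rfl⟩
  | inv x _ hx =>
    obtain ⟨p, e, f, rfl⟩ := hx
    exact ⟨_, _, _, by rw [← map_inv, inv_def]; simp; rfl⟩

/-- The double coset `W₀ t^{(1/2,1/2)} W₀` in the model. -/
def IsHalf (m : SgnAff) : Prop := (m.a = 1 ∨ m.a = -1) ∧ (m.b = 1 ∨ m.b = -1)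

instance : DecidablePred IsHalf := fun m => by unfold IsHalf; infer_instance

theorem IsHalf.odd {m : SgnAff} (hm : IsHalf m) : Odd m.a := by
  rcases hm.1 with h | h <;> rw [h] <;> decide

theorem IsHalf.linear_mul_mul {m : SgnAff} (hm : IsHalf m) (p e f p' e' f' : Bool) :
    IsHalf (⟨p, e, f, 0, 0⟩ * m * ⟨p', e', f', 0, 0⟩) := by
  obtain ⟨p'', e'', f'', a, b⟩ := m
  obtain ⟨rfl | rfl, rfl | rfl⟩ := hm <;> cases p <;> cases e <;> cases f <;>
    simp [IsHalf, mul_def, sg]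

theorem twiceLen_transl_mul_tau_inv {m : SgnAff} (hm : IsHalf m) (hp : m.p = false)
    (he : m.e = false) (hf : m.f = false) : twiceLen (m * tau⁻¹) = 6 := by
  obtain ⟨p, e, f, a, b⟩ := m
  obtain ⟨rfl | rfl, rfl | rfl⟩ := hm <;> subst hp he hf <;> decide

theorem isHalf_subword : ∀ i j k : Fin 3,
    (word [i, j, k] * tau).p = false → (word [i, j, k] * tau).e = false →
    (word [i, j, k] * tau).f = false →
    ∀ l ∈ [i, j, k].sublists, IsHalf (word l * tau) := by
  decide +kernel

theorem exists_isHalf_of_mem_Adm {w : Wt2} (hw : w ∈ Adm fun _ => 1 / 2) :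
    ∃ m, IsHalf m ∧ w = toPerm m := by
  obtain ⟨x, hx, u, u', om, hom, rfl, hu', l, l', hl, hsub, rfl⟩ := hw
  obtain ⟨p, e, f, rfl⟩ := exists_linear_of_mem_W0 hx
  have ht : transl (toPerm ⟨p, e, f, 0, 0⟩ fun _ => 1 / 2) =
      toPerm ⟨false, false, false, sg e, sg f⟩ := by
    rw [toPerm_transl]
    congr 1
    funext i
    fin_cases i <;> simp [toPerm_apply, act] <;> ring
  have half : IsHalf ⟨false, false, false, sg e, sg f⟩ := by
    cases e <;> cases f <;> decide
  rw [ht] at hu'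
  obtain ⟨rfl, n, rfl, hn, hlen⟩ := word_of_odd half.odd hom hu' hl
  rw [twiceLen_transl_mul_tau_inv half rfl rfl rfl] at hlen
  obtain ⟨n', hn', rfl⟩ := List.sublist_map_iff.1 hsub
  obtain ⟨i, j, k, rfl⟩ := List.length_eq_three.1 (show n.length = 3 by omega)
  refine ⟨word n' * tau, ?_, by rw [prod_map_toPerm, map_mul, toPerm_tau]⟩
  have hn2 : word [i, j, k] * tau = ⟨false, false, false, sg e, sg f⟩ := by
    rw [hn, inv_mul_cancel_right]
  exact isHalf_subword i j k (by rw [hn2]) (by rw [hn2]) (by rw [hn2]) n' (List.mem_sublists.2 hn')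

/-- The initial subwords of `s₀ s₁ s₀`. -/
def initialWords : List (List (Fin 3)) := [[], [0], [0, 1], [0, 1, 0]]

theorem exists_word_of_twiceLen_le {m : SgnAff} (hm : IsHalf m)
    (h1 : twiceLen m ≤ twiceLen (gen 1 * m)) (h2 : twiceLen m ≤ twiceLen (gen 2 * m)) :
    ∃ l ∈ initialWords, m = word l * tau := by
  obtain ⟨p, e, f, a, b⟩ := m
  obtain ⟨rfl | rfl, rfl | rfl⟩ := hm <;> revert p e f <;> decide +kernel

theorem twiceLen_initialWords_le : ∀ l ∈ initialWords, ∀ p e f : Bool,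
    twiceLen (word l * tau) ≤ twiceLen (⟨p, e, f, 0, 0⟩ * (word l * tau)) := by
  decide +kernel

theorem ell_toPerm_le_iff (m n : SgnAff) :
    ell (toPerm m) ≤ ell (toPerm n) ↔ twiceLen m ≤ twiceLen n := by
  rw [ell_toPerm, ell_toPerm, div_le_div_iff_of_pos_right two_pos, Int.cast_le]

theorem mem_EO_iff (w : Wt2) : w ∈ EO {s1, s2} (fun _ => 1 / 2) ↔
    ∃ l ∈ initialWords, w = toPerm (word l * tau) := by
  constructor
  · rintro ⟨⟨x, hx, y, hy, a, ha, rfl⟩, hmin⟩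
    obtain ⟨p, e, f, rfl⟩ := exists_linear_of_mem_W0 hx
    obtain ⟨p', e', f', rfl⟩ := exists_linear_of_mem_W0 hy
    obtain ⟨m, hm, rfl⟩ := exists_isHalf_of_mem_Adm ha
    rw [← map_mul, ← map_mul] at hmin ⊢
    have h1 := hmin s1 (Subgroup.subset_closure (by simp))
    have h2 := hmin s2 (Subgroup.subset_closure (by simp))
    rw [← toPerm_gen_one, ← map_mul, ell_toPerm_le_iff] at h1
    rw [← toPerm_gen_two, ← map_mul, ell_toPerm_le_iff] at h2
    obtain ⟨l, hl, h⟩ := exists_word_of_twiceLen_le (hm.linear_mul_mul p e f p' e' f') h1 h2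
    exact ⟨l, hl, by rw [h]⟩
  · rintro ⟨l, hl, rfl⟩
    refine ⟨⟨1, one_mem _, 1, one_mem _, _, ?_, by rw [one_mul, mul_one]⟩, ?_⟩
    · refine ⟨1, one_mem _, toPerm (word l), toPerm (word [0, 1, 0]), tau2, by simp [Om], ?_, ?_,
        _, _, isRed_toPerm _ (by decide), ?_, prod_map_toPerm l⟩
      · rw [map_mul, toPerm_tau]
      · have : word [0, 1, 0] * tau = ⟨false, false, false, 1, 1⟩ := by decide
        rw [← toPerm_tau, ← map_mul, this, toPerm_transl]
        congr 1
        funext i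
        fin_cases i <;> simp
      · refine List.Sublist.map _ ?_
        revert l
        decide
    · intro x hx
      obtain ⟨p, e, f, rfl⟩ := exists_linear_of_mem_W0 hx
      rw [← map_mul, ell_toPerm_le_iff]
      exact twiceLen_initialWords_le l hl p e f

theorem conj_tau_gen (i : Fin 3) :
    MulAut.conj tau2 (toPerm (gen i)) = toPerm (gen (Fin.rev i)) := by
  rw [MulAut.conj_apply, ← toPerm_tau, ← map_inv, ← map_mul, ← map_mul]
  congr 1
  revert i
  decide

theorem zpow_conj_mem_St {om : Wt2} (hom : om ∈ Om) (k : ℤ) {s : Wt2} (hs : s ∈ St) :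
    (MulAut.conj om ^ k) s ∈ St := by
  rcases hom with rfl | rfl
  · simpa using hs
  have hsq : MulAut.conj tau2 * MulAut.conj tau2 = 1 := by
    rw [← map_mul, ← toPerm_tau, ← map_mul, show tau * tau = 1 by decide, map_one, map_one]
  rcases Int.even_or_odd' k with ⟨j, rfl | rfl⟩
  · rwa [zpow_mul, zpow_two, hsq, one_zpow]
  · rw [zpow_add, zpow_mul, zpow_two, hsq, one_zpow, one_mul, zpow_one]
    obtain ⟨i, rfl⟩ := (mem_St_iff s).1 hs
    rw [conj_tau_gen]
    exact (mem_St_iff _).2 ⟨_, rfl⟩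

theorem suppsig_subset (w : Wt2) : suppsig 1 w ⊆ St := by
  rintro _ ⟨u, om, l, hom, -, hl, s, hs, k, rfl⟩
  rw [deltaW, mul_one]
  exact zpow_conj_mem_St hom k (hl.1 s hs)

theorem suppsig_eq_St (l : List (Fin 3)) (h : 2 * (l.length : ℤ) = twiceLen (word l))
    (h0 : 0 ∈ l) (h1 : 1 ∈ l) : suppsig 1 (toPerm (word l * tau)) = St := by
  refine (suppsig_subset _).antisymm fun s hs => ?_
  refine ⟨toPerm (word l), tau2, _, by simp [Om], by rw [map_mul, toPerm_tau], isRed_toPerm l h, ?_⟩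
  obtain ⟨i, rfl⟩ := (mem_St_iff s).1 hs
  rw [deltaW, mul_one]
  fin_cases i
  · exact ⟨_, List.mem_map_of_mem h0, 0, rfl⟩
  · exact ⟨_, List.mem_map_of_mem h1, 0, rfl⟩
  · exact ⟨_, List.mem_map_of_mem h0, 1, by rw [zpow_one, conj_tau_gen]; rfl⟩

theorem suppsig_tau : suppsig 1 tau2 = ∅ := by
  rw [Set.eq_empty_iff_forall_notMem]
  rintro _ ⟨u, om, l, hom, h, hl, s, hs, k, rfl⟩
  rw [← toPerm_tau] at h
  obtain ⟨-, n, rfl, -, hlen⟩ := word_of_odd (by decide) hom h hl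
  rw [mul_inv_cancel, show twiceLen 1 = 0 by decide] at hlen
  rw [List.length_eq_zero_iff.1 (show n.length = 0 by omega)] at hs
  simp at hs

theorem suppsig_s0_mul_tau :
    suppsig 1 (s0 * tau2) = {t | ∃ k : ℤ, (deltaW 1 tau2 ^ k) s0 = t} := by
  ext t
  constructor
  · rintro ⟨u, om, l, hom, h, hl, s, hs, k, rfl⟩
    rw [← toPerm_gen_zero, ← toPerm_tau, ← map_mul] at h
    obtain ⟨rfl, n, rfl, hn, hlen⟩ := word_of_odd (by decide) hom h hl
    rw [mul_inv_cancel_right] at hn hlen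
    rw [show twiceLen (gen 0) = 2 by decide] at hlen
    obtain ⟨i, rfl⟩ := List.length_eq_one_iff.1 (show n.length = 1 by omega)
    simp only [word, List.map_cons, List.map_nil, List.prod_singleton] at hn
    simp only [List.map_cons, List.map_nil, List.mem_singleton, hn, toPerm_gen_zero] at hs
    exact ⟨k, by rw [hs]⟩
  · rintro ⟨k, rfl⟩
    refine ⟨s0, tau2, [s0], by simp [Om], rfl, ?_, s0, by simp, k, rfl⟩
    have := isRed_toPerm [0] (by decide)
    simpa [word, toPerm_gen_zero] using this

theorem s1_notMem_suppsig_s0_mul_tau : s1 ∉ suppsig 1 (s0 * tau2) := by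
  rw [suppsig_s0_mul_tau]
  rintro ⟨k, hk⟩
  rw [deltaW, mul_one] at hk
  have hfix : MulAut.conj tau2 ∈ MulAction.stabilizer (MulAut Wt2) s1 := by
    rw [MulAction.mem_stabilizer_iff, MulAut.smul_def, ← toPerm_gen_one, conj_tau_gen]
    rfl
  have hfix' := zpow_mem hfix k
  rw [MulAction.mem_stabilizer_iff, MulAut.smul_def, ← hk] at hfix'
  have h := (MulAut.conj tau2 ^ k).injective hfix'
  rw [hk, ← toPerm_gen_zero, ← toPerm_gen_one] at h
  exact absurd (toPerm_injective h) (by decide)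

theorem orbCount_orbit (δ : MulAut Wt2) (s : Wt2) :
    orbCount δ {t | ∃ k : ℤ, (δ ^ k) s = t} = 1 := by
  rw [orbCount, Set.ncard_eq_one]
  refine ⟨{t | ∃ k : ℤ, (δ ^ k) s = t}, Set.ext fun O => ⟨?_, ?_⟩⟩
  · rintro ⟨_, ⟨k, rfl⟩, rfl⟩
    refine Set.ext fun t => ⟨?_, ?_⟩
    · rintro ⟨j, rfl⟩
      exact ⟨j + k, by rw [zpow_add, MulAut.mul_apply]⟩
    · rintro ⟨j, rfl⟩
      exact ⟨j - k, by rw [← MulAut.mul_apply, ← zpow_add, sub_add_cancel]⟩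
  · rintro rfl
    exact ⟨s, ⟨0, rfl⟩, rfl⟩

theorem sigmaProd_one (w : Wt2) (k : ℕ) : sigmaProd 1 w k = w ^ k := by
  simp [sigmaProd]

theorem isStraight_toPerm (m : SgnAff) (h : ∀ k : ℕ, twiceLen (m ^ k) = k * twiceLen m) :
    IsStraight 1 (toPerm m) := by
  intro k _
  rw [sigmaProd_one, ← map_pow, ell_toPerm, ell_toPerm, h]
  push_cast
  ring

theorem s0_s1_tau_eq : s0 * s1 * tau2 = toPerm (word [0, 1] * tau) := by
  simp [word, toPerm_gen_zero, toPerm_gen_one, toPerm_tau]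

theorem s0_s1_s0_tau_eq : s0 * s1 * s0 * tau2 = toPerm (word [0, 1, 0] * tau) := by
  simp [word, toPerm_gen_zero, toPerm_gen_one, toPerm_tau, mul_assoc]

theorem pow_screw (k : ℕ) : (⟨false, false, true, 1, 1⟩ : SgnAff) ^ k =
    if Even k then ⟨false, false, false, k, 0⟩ else ⟨false, false, true, k, 1⟩ := by
  induction k with
  | zero => decide
  | succ k ih =>
    rw [pow_succ, ih]
    by_cases hk : Even k <;> simp [hk, Nat.even_add_one, mul_def, sg]

theorem pow_transl (k : ℕ) : (⟨false, false, false, 1, 1⟩ : SgnAff) ^ k =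
    ⟨false, false, false, k, k⟩ := by
  induction k with
  | zero => decide
  | succ k ih =>
    rw [pow_succ, ih]
    simp [mul_def, sg]

theorem isStraight_s0_s1_tau : IsStraight 1 (s0 * s1 * tau2) := by
  rw [s0_s1_tau_eq, show word [0, 1] * tau = ⟨false, false, true, 1, 1⟩ by decide]
  refine isStraight_toPerm _ fun k => ?_
  rw [pow_screw, show twiceLen ⟨false, false, true, 1, 1⟩ = 4 by decide]
  by_cases hk : Even k
  · simp [hk, twiceLen]
    ring
  · have : 1 ≤ k := Nat.pos_of_ne_zero (by rintro rfl; exact hk Even.zero)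
    have h1 : |(k : ℤ) - 1| = k - 1 := abs_of_nonneg (by omega)
    have h2 : |(k : ℤ) + 1| = k + 1 := abs_of_nonneg (by omega)
    simp [hk, twiceLen, h1, h2]
    ring

theorem isStraight_s0_s1_s0_tau : IsStraight 1 (s0 * s1 * s0 * tau2) := by
  rw [s0_s1_s0_tau_eq, show word [0, 1, 0] * tau = ⟨false, false, false, 1, 1⟩ by decide]
  refine isStraight_toPerm _ fun k => ?_
  rw [pow_transl, show twiceLen ⟨false, false, false, 1, 1⟩ = 6 by decide]
  have h : |(k : ℤ) + k| = k + k := abs_of_nonneg (by omega)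
  simp [twiceLen, h]
  ring

theorem isNewton_s0_s1_tau :
    IsNewton 1 (s0 * s1 * tau2) (fun j => if (j : ℕ) = 0 then 1/2 else 0) := by
  refine ⟨2, ![(2 : ℤ) / 2, (0 : ℤ) / 2], by norm_num, one_pow _, ?_,
    ⟨1, one_mem _, ?_⟩, by norm_num, by norm_num⟩
  · rw [sigmaProd_one, s0_s1_tau_eq, ← map_pow, ← toPerm_transl]
    congr 1
  · funext j
    fin_cases j <;> simp

theorem isNewton_s0_s1_s0_tau : IsNewton 1 (s0 * s1 * s0 * tau2) (fun _ => 1/2) := by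
  refine ⟨1, ![(1 : ℤ) / 2, (1 : ℤ) / 2], le_rfl, one_pow _, ?_,
    ⟨1, one_mem _, ?_⟩, le_rfl, by norm_num⟩
  · rw [sigmaProd_one, s0_s1_s0_tau_eq, ← map_pow, ← toPerm_transl]
    congr 1
  · funext j
    fin_cases j <;> simp

theorem EO_eq : EO {s1, s2} (fun _ => 1 / 2) =
    {tau2, s0 * tau2, s0 * s1 * tau2, s0 * s1 * s0 * tau2} := by
  ext w
  rw [mem_EO_iff, s0_s1_tau_eq, s0_s1_s0_tau_eq]
  simp [initialWords, word, toPerm_gen_zero, toPerm_tau]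

theorem isCox_tau : IsCox 1 tau2 := by
  refine ⟨1, tau2, by simp [Om], (one_mul _).symm, ?_⟩
  rw [suppsig_tau, ← map_one toPerm, ell_toPerm, show twiceLen 1 = 0 by decide]
  simp [orbCount]

theorem isCox_s0_mul_tau : IsCox 1 (s0 * tau2) := by
  refine ⟨s0, tau2, by simp [Om], rfl, ?_⟩
  rw [suppsig_s0_mul_tau, orbCount_orbit, ← toPerm_gen_zero, ell_toPerm,
    show twiceLen (gen 0) = 2 by decide]
  norm_num

theorem suppsig_s0_s1_tau : suppsig 1 (s0 * s1 * tau2) = St := by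
  rw [s0_s1_tau_eq]
  exact suppsig_eq_St _ (by decide) (by decide) (by decide)

theorem suppsig_s0_s1_s0_tau : suppsig 1 (s0 * s1 * s0 * tau2) = St := by
  rw [s0_s1_s0_tau_eq]
  exact suppsig_eq_St _ (by decide) (by decide) (by decide)

theorem s1_mem_St : s1 ∈ St := by simp [St]

theorem suppsig_tau_ne : suppsig 1 tau2 ≠ St := by
  rw [suppsig_tau]
  exact fun h => (h ▸ s1_mem_St : s1 ∈ (∅ : Set Wt2))

theorem suppsig_s0_mul_tau_ne : suppsig 1 (s0 * tau2) ≠ St :=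
  fun h => s1_notMem_suppsig_s0_mul_tau (h ▸ s1_mem_St)

end SgnAff

open SgnAff in
/-- (C̃₂, ω₂^∨, 𝕊, id). -/
theorem statement13 :
    EOcox 1 {s1, s2} (fun _ => 1/2) = {tau2, s0 * tau2} ∧
    EO {s1, s2} (fun _ => 1/2) \ EOcox 1 {s1, s2} (fun _ => 1/2) =
      {s0 * s1 * tau2, s0 * s1 * s0 * tau2} ∧
    (IsStraight 1 (s0 * s1 * tau2) ∧ IsStraight 1 (s0 * s1 * s0 * tau2)) ∧
    (IsNewton 1 (s0 * s1 * tau2) (fun j => if (j : ℕ) = 0 then 1/2 else 0) ∧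
     IsNewton 1 (s0 * s1 * s0 * tau2) (fun _ => 1/2)) := by
  refine ⟨?_, ?_, ⟨isStraight_s0_s1_tau, isStraight_s0_s1_s0_tau⟩,
    isNewton_s0_s1_tau, isNewton_s0_s1_s0_tau⟩
  · ext w
    rw [EOcox, Set.mem_ofPred_eq, EO_eq]
    constructor
    · rintro ⟨rfl | rfl | rfl | rfl, hsupp, -⟩
      · simp
      · simp
      · exact absurd suppsig_s0_s1_tau hsupp
      · exact absurd suppsig_s0_s1_s0_tau hsupp
    · rintro (rfl | rfl)
      · exact ⟨by simp, suppsig_tau_ne, isCox_tau⟩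
      · exact ⟨by simp, suppsig_s0_mul_tau_ne, isCox_s0_mul_tau⟩
  · ext w
    rw [Set.mem_sdiff, EOcox, Set.mem_ofPred_eq, EO_eq]
    constructor
    · rintro ⟨rfl | rfl | rfl | rfl, h⟩
      · exact absurd ⟨by simp, suppsig_tau_ne, isCox_tau⟩ h
      · exact absurd ⟨by simp, suppsig_s0_mul_tau_ne, isCox_s0_mul_tau⟩ h
      · simp
      · simp
    · rintro (rfl | rfl)
      · exact ⟨by simp, fun h => h.2.1 suppsig_s0_s1_tau⟩
      · exact ⟨by simp, fun h => h.2.1 suppsig_s0_s1_s0_tau⟩
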